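/- arXiv:1312.3837 — 2 statements merged into one kernel-verified Lean document; each statement's English description precedes it below -/
import Mathlib

section
/- Let t ≥ 2, d ≥ t − 1, and v = t·d. Let s : (ℤ/tℤ) × (ℤ/tℤ) → ℤ/dℤ, and let M be the v×v 0,1-matrix with rows and columns indexed by (ℤ/tℤ) × (ℤ/dℤ) defined by M((i,x),(j,y)) = 1 if and only if y − x = s(i,j); thus M is a block double-circulant matrix whose t² blocks are circulant d×d permutation matrices, with weight vector (1,1,…,1), and every row and column of M has exactly t ones. Suppose M contains no 2×2 all-ones submatrix, so that M is an incidence matrix of a symmetric configuration (td)_t. Then for every integer c with 2 ≤ c ≤ t, every integer θ with 0 ≤ θ ≤ c + 1, and every integer δ with 0 ≤ δ < c, there exists a symmetric configuration v′_{k′} with v′ = c·d + θ and k′ = c − δ. -/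
/-- A 0,1-matrix (given as a `Bool`-valued function) contains no 2×2 all-ones
submatrix: there are no two distinct row indices and two distinct column
indices such that all four corresponding entries are 1. -/
def NoRect {α β : Type*} (M : α → β → Bool) : Prop :=
  ∀ i₁ i₂ j₁ j₂, i₁ ≠ i₂ → j₁ ≠ j₂ →
    M i₁ j₁ = true → M i₁ j₂ = true → M i₂ j₁ = true → M i₂ j₂ = true → False

/-- `M` is an incidence matrix of a symmetric configuration with parameter `k`:
every row and every column contains exactly `k` ones, and there is no
2×2 all-ones submatrix. -/
def IsIncidence {α β : Type*} [Fintype α] [Fintype β]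
    (k : ℕ) (M : α → β → Bool) : Prop :=
  (∀ i : α, (Finset.univ.filter (fun j => M i j = true)).card = k) ∧
  (∀ j : β, (Finset.univ.filter (fun i => M i j = true)).card = k) ∧
  NoRect M

/-- A symmetric configuration `v_k` exists: there is a `v × v` 0,1-matrix with
exactly `k` ones in every row and column and no 2×2 all-ones submatrix. -/
def ConfigExists (v k : ℕ) : Prop :=
  ∃ M : Fin v → Fin v → Bool, IsIncidence k M

/-- `A` is a `(v,k)` modular Golomb ruler: a `k`-element subset of `ℤ/vℤ`
such that all differences `a - a'` with `a ≠ a'` in `A` are nonzero and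
pairwise distinct. -/
def IsModularGolombRuler (v k : ℕ) (A : Finset (ZMod v)) : Prop :=
  A.card = k ∧
  (∀ a ∈ A, ∀ a' ∈ A, a ≠ a' → a - a' ≠ 0) ∧
  (∀ a ∈ A, ∀ a' ∈ A, ∀ b ∈ A, ∀ b' ∈ A, a ≠ a' → b ≠ b' →
    a - a' = b - b' → a = b ∧ a' = b')

/-- `a` is a Golomb ruler of order `k`: `k` nonnegative integers in strictly
increasing order all of whose differences `a i - a j` with `i ≠ j` are
pairwise distinct. -/
def IsGolombRuler (k : ℕ) (a : Fin k → ℤ) : Prop :=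
  (∀ i, 0 ≤ a i) ∧ StrictMono a ∧
  (∀ i j i' j' : Fin k, i ≠ j → i' ≠ j' → a i - a j = a i' - a j' → i = i' ∧ j = j')

/-- The relation of the extended matrix. -/
def extRel {G : Type*} [AddCommGroup G] (c θ : ℕ) (R : Finset G) (u : Fin c → Fin c → G) :
    ((Fin c × G) ⊕ Fin θ) → ((Fin c × G) ⊕ Fin θ) → Prop
  | .inl p, .inl q => q.2 = p.2 + u p.1 q.1 ∧ ¬ (p.1 = q.1 ∧ p.1.val < θ ∧ p.2 ∈ R)
  | .inl p, .inr a => p.1.val = a.val ∧ p.2 ∈ R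
  | .inr a, .inl q => q.1.val = a.val ∧ q.2 ∈ R
  | .inr a, .inr b => (θ = c + 1 ∧ (a.val = c ∧ b.val ≠ c ∨ a.val ≠ c ∧ b.val = c)) ∨
      (θ ≠ c + 1 ∧ a.val = b.val)

lemma extRel_transpose {G : Type*} [AddCommGroup G] (c θ : ℕ) (R : Finset G)
    (u : Fin c → Fin c → G) (hu : ∀ i, u i i = 0) (p q : (Fin c × G) ⊕ Fin θ) :
    extRel c θ R u p q ↔ extRel c θ R (fun i j => - u j i) q p := by
  rcases p with ⟨i, x⟩ | a <;> rcases q with ⟨j, y⟩ | b <;> simp only [extRel]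
  · have : y = x + u i j ↔ x = y + - u i j := by
      constructor <;> (rintro rfl; abel)
    rw [← this]
    apply and_congr_right
    intro h
    by_cases hij : i = j
    · subst hij
      rw [hu, add_zero] at h
      subst h
      rfl
    · simp [hij, Ne.symm hij]
  · grind

open Classical in
lemma extRel_row {G : Type*} [AddCommGroup G] [Fintype G] (c θ : ℕ) (R : Finset G)
    (hc : 2 ≤ c) (hθ : θ ≤ c + 1) (hR : R.card = c - 1)
    (u : Fin c → Fin c → G) (p : (Fin c × G) ⊕ Fin θ) :
    (Finset.univ.filter (fun q => extRel c θ R u p q)).card = c := by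
  rw [Finset.card_filter, Fintype.sum_sum_type, Fintype.sum_prod_type]
  rcases p with ⟨i, x⟩ | a
  · have E : ∀ j y, (if extRel c θ R u (.inl (i, x)) (.inl (j, y)) then 1 else 0) =
        (if y = x + u i j ∧ ¬ (i = j ∧ i.val < θ ∧ x ∈ R) then 1 else 0) :=
      fun _ _ => if_congr Iff.rfl rfl rfl
    have E' : ∀ a, (if extRel c θ R u (.inl (i, x)) (.inr a) then 1 else 0) =
        (if i.val = a.val ∧ x ∈ R then 1 else 0) :=
      fun _ => if_congr Iff.rfl rfl rfl
    simp only [E, E']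
    have h1 : ∀ j : Fin c, (∑ y : G, if y = x + u i j ∧ ¬ (i = j ∧ i.val < θ ∧ x ∈ R) then 1 else 0)
        = if (i = j ∧ i.val < θ ∧ x ∈ R) then 0 else 1 := by
      intro j
      by_cases h : (i = j ∧ i.val < θ ∧ x ∈ R)
      · rw [if_pos h]
        exact Finset.sum_eq_zero fun y _ => if_neg fun h' => h'.2 h
      · rw [if_neg h]
        simp only [h, not_false_eq_true, and_true]
        simp
    simp only [h1]
    by_cases h : i.val < θ ∧ x ∈ R
    · simp only [h, and_true, and_self]
      have h2 : ∀ a : Fin θ, i.val = a.val ↔ a = ⟨i.val, h.1⟩ := by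
        intro a; rw [Fin.ext_iff]; exact eq_comm
      simp only [h2]
      have h3 : ∀ j : Fin c, (if i = j then 0 else 1) = if j ∈ Finset.univ.erase i then 1 else 0 := by
        intro j; simp [eq_comm]
      simp only [h3]
      rw [Finset.sum_ite_mem]
      simp
      omega
    · have h2 : ∀ a : Fin θ, ¬ (i.val = a.val ∧ x ∈ R) := by
        rintro a ⟨h3, h4⟩
        exact h ⟨h3 ▸ a.2, h4⟩
      simp [h, h2]
  · have E : ∀ j y, (if extRel c θ R u (.inr a) (.inl (j, y)) then 1 else 0) =
        (if j.val = a.val ∧ y ∈ R then 1 else 0) :=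
      fun _ _ => if_congr Iff.rfl rfl rfl
    have E' : ∀ b : Fin θ, (if extRel c θ R u (.inr a) (.inr b) then 1 else 0) =
        (if ((θ = c + 1 ∧ (a.val = c ∧ b.val ≠ c ∨ a.val ≠ c ∧ b.val = c)) ∨
          (θ ≠ c + 1 ∧ a.val = b.val)) then 1 else 0) :=
      fun _ => if_congr Iff.rfl rfl rfl
    simp only [E, E']
    have h1 : ∀ j : Fin c, (∑ y : G, if j.val = a.val ∧ y ∈ R then 1 else 0)
        = if j.val = a.val then c - 1 else 0 := by
      intro j
      by_cases h : j.val = a.val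
      · simp [h, hR]
      · simp [h]
    simp only [h1]
    by_cases ha : a.val < c
    · have h2 : ∀ j : Fin c, j.val = a.val ↔ j = ⟨a.val, ha⟩ := by
        intro j; rw [Fin.ext_iff]
      simp only [h2]
      have h3 : ∃ e : Fin θ, ∀ b : Fin θ, ((θ = c + 1 ∧ (a.val = c ∧ b.val ≠ c ∨ a.val ≠ c ∧ b.val = c)) ∨
          (θ ≠ c + 1 ∧ a.val = b.val)) ↔ b = e := by
        by_cases hh : θ = c + 1
        · refine ⟨⟨c, by omega⟩, fun b => ?_⟩
          rw [Fin.ext_iff]; simp only; omega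
        · refine ⟨a, fun b => ?_⟩
          rw [Fin.ext_iff]; omega
      obtain ⟨e, he⟩ := h3
      simp only [he]
      simp
      omega
    · have hac : a.val = c := by omega
      have hh : θ = c + 1 := by omega
      have h2 : ∀ j : Fin c, ¬ (j.val = a.val) := by intro j; omega
      have h3 : ∀ b : Fin θ, ((θ = c + 1 ∧ (a.val = c ∧ b.val ≠ c ∨ a.val ≠ c ∧ b.val = c)) ∨
          (θ ≠ c + 1 ∧ a.val = b.val)) ↔ b ∈ Finset.univ.erase a := by
        intro b
        simp only [Finset.mem_erase, Finset.mem_univ, and_true, ne_eq, Fin.ext_iff]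
        omega
      simp only [h2, h3]
      rw [Finset.sum_ite_mem]
      simp
      omega

lemma extRel_noRect {G : Type*} [AddCommGroup G] (c θ : ℕ) (R : Finset G)
    (u : Fin c → Fin c → G) (hu : ∀ i, u i i = 0)
    (H : ∀ i i' j j', i ≠ i' → j ≠ j' → u i j - u i' j ≠ u i j' - u i' j')
    (p p' q q' : (Fin c × G) ⊕ Fin θ) (hp : p ≠ p') (hq : q ≠ q')
    (h1 : extRel c θ R u p q) (h2 : extRel c θ R u p q')
    (h3 : extRel c θ R u p' q) (h4 : extRel c θ R u p' q') : False := by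
  have key : ∀ (i i' j j' : Fin c) (x x' y y' : G), y = x + u i j → y' = x + u i j' →
      y = x' + u i' j → y' = x' + u i' j' → i = i' ∨ j = j' := by
    intro i i' j j' x x' y y' e1 e2 e3 e4
    by_contra hcon
    push Not at hcon
    refine H i i' j j' hcon.1 hcon.2 ?_
    have a1 : u i j - u i' j = x' - x := by
      rw [e1] at e3
      rw [sub_eq_sub_iff_add_eq_add, add_comm, e3]
    have a2 : u i j' - u i' j' = x' - x := by
      rw [e2] at e4
      rw [sub_eq_sub_iff_add_eq_add, add_comm, e4]
    rw [a1, a2]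
  rcases p with ⟨i, x⟩ | a <;> rcases p' with ⟨i', x'⟩ | a' <;>
  rcases q with ⟨j, y⟩ | b <;> rcases q' with ⟨j', y'⟩ | b' <;>
  simp only [extRel] at h1 h2 h3 h4 <;>
  simp only [ne_eq, Sum.inl.injEq, Sum.inr.injEq, Prod.mk.injEq, reduceCtorEq, not_false_eq_true, Fin.ext_iff] at hp hq h1 h2 h3 h4
  · have := key i i' j j' x x' y y' h1.1 h2.1 h3.1 h4.1
    rcases this with rfl | rfl
    · have : x = x' := by
        have := h1.1.symm.trans h3.1
        exact add_right_cancel this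
      exact hp ⟨rfl, this⟩
    · have : y = y' := h1.1.trans h2.1.symm
      exact hq ⟨rfl, this⟩
  all_goals try (exfalso; omega)
  all_goals try grind

lemma config_of_rel {V : Type*} [Fintype V] [DecidableEq V] (k : ℕ) (M : V → V → Bool)
    (h : IsIncidence k M) (v : ℕ) (hv : Fintype.card V = v) : ConfigExists v k := by
  let e : Fin v ≃ V := (Fintype.equivFinOfCardEq hv).symm
  refine ⟨fun i j => M (e i) (e j), fun i => ?_, fun j => ?_, ?_⟩
  · rw [← h.1 (e i)]
    exact Finset.card_equiv e (by simp)
  · rw [← h.2.1 (e j)]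
    exact Finset.card_equiv e (by simp)
  · intro i i' j j' hi hj
    exact h.2.2 _ _ _ _ (e.injective.ne hi) (e.injective.ne hj)

lemma config_pred (v k : ℕ) (h : ConfigExists v (k + 1)) : ConfigExists v k := by
  obtain ⟨M, hr, hc, hn⟩ := h
  have hall : ∃ f : Fin v → Fin v, Function.Injective f ∧
      ∀ x, f x ∈ Finset.univ.filter (fun j => M x j = true) := by
    rw [← Finset.all_card_le_biUnion_card_iff_exists_injective]
    intro A
    have := Finset.card_mul_le_card_mul (fun i j => M i j = true) (s := A)
      (t := A.biUnion fun x => Finset.univ.filter (fun j => M x j = true)) (m := k + 1) (n := k + 1)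
      (fun a ha => by
        rw [← hr a]
        apply Finset.card_le_card
        intro j hj
        simp only [Finset.mem_filter, Finset.mem_univ, true_and] at hj
        simp only [Finset.mem_bipartiteAbove, Finset.mem_biUnion, Finset.mem_filter,
          Finset.mem_univ, true_and]
        exact ⟨⟨a, ha, hj⟩, hj⟩)
      (fun b hb => by
        rw [← hc b]
        apply Finset.card_le_card
        intro j hj
        simp only [Finset.mem_bipartiteBelow] at hj
        simp [hj.2])
    exact Nat.le_of_mul_le_mul_right this (by omega)
  obtain ⟨f, hf, hfm⟩ := hall
  simp only [Finset.mem_filter, Finset.mem_univ, true_and] at hfm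
  have hfs : Function.Surjective f := Finite.surjective_of_injective hf
  refine ⟨fun i j => M i j && !decide (f i = j), fun i => ?_, fun j => ?_, ?_⟩
  · have : (Finset.univ.filter (fun j => (M i j && !decide (f i = j)) = true))
        = (Finset.univ.filter (fun j => M i j = true)).erase (f i) := by
      ext j; simp; grind
    rw [this, Finset.card_erase_of_mem (by simp [hfm]), hr]; rfl
  · obtain ⟨i0, rfl⟩ := hfs j
    have : (Finset.univ.filter (fun i => (M i (f i0) && !decide (f i = f i0)) = true))
        = (Finset.univ.filter (fun i => M i (f i0) = true)).erase i0 := by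
      ext j; simp [hf.eq_iff]; grind
    rw [this, Finset.card_erase_of_mem (by simp [hfm]), hc]; rfl
  · intro i i' j j' hi hj h1 h2 h3 h4
    simp only [Bool.and_eq_true] at h1 h2 h3 h4
    exact hn i i' j j' hi hj h1.1 h2.1 h3.1 h4.1

lemma config_sub (v k δ : ℕ) (hδ : δ ≤ k) (h : ConfigExists v k) : ConfigExists v (k - δ) := by
  induction δ with
  | zero => exact h
  | succ n ih =>
    apply config_pred
    have : k - (n + 1) + 1 = k - n := by omega
    rw [this]
    exact ih (by omega)

/-- If a `td × td` block double-circulant matrix whose `t²` blocks are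
circulant `d × d` permutation matrices (weight vector `(1,1,…,1)`) has no
2×2 all-ones submatrix — hence is an incidence matrix of a symmetric
configuration `(td)_t` — then for every `2 ≤ c ≤ t`, `0 ≤ θ ≤ c + 1` and
`0 ≤ δ < c`, a symmetric configuration with `v' = cd + θ` and `k' = c - δ`
exists. -/
theorem config_from_bdc_all_ones_weight (t d : ℕ) (ht : 2 ≤ t)
    (hd : t - 1 ≤ d) (s : Fin t → Fin t → Fin d)
    (hM : NoRect (fun p q : Fin t × Fin d => decide (q.2 - p.2 = s p.1 q.1)))
    (c θ δ : ℕ) (hc2 : 2 ≤ c) (hct : c ≤ t) (hθ : θ ≤ c + 1) (hδ : δ < c) :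
    ConfigExists (c * d + θ) (c - δ) := by
  apply config_sub _ _ _ hδ.le
  classical
  haveI : NeZero d := ⟨by omega⟩
  let ι : Fin c → Fin t := Fin.castLE hct
  have hι : Function.Injective ι := Fin.castLE_injective hct
  let u : Fin c → Fin c → Fin d := fun i j => s (ι i) (ι j) - s (ι j) (ι j)
  have hu : ∀ i, u i i = 0 := fun i => sub_self _
  have H : ∀ i i' j j', i ≠ i' → j ≠ j' → u i j - u i' j ≠ u i j' - u i' j' := by
    intro i i' j j' hi hj he
    simp only [u, sub_sub_sub_cancel_right] at he
    refine hM (ι i, 0) (ι i', s (ι i) (ι j) - s (ι i') (ι j)) (ι j, s (ι i) (ι j))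
      (ι j', s (ι i) (ι j')) ?_ ?_ ?_ ?_ ?_ ?_
    · intro h; exact hi (hι (Prod.mk.inj h).1)
    · intro h; exact hj (hι (Prod.mk.inj h).1)
    · simp
    · simp
    · simp
    · simp [he]
  obtain ⟨R, -, hR⟩ := Finset.exists_subset_card_eq
    (s := (Finset.univ : Finset (Fin d))) (n := c - 1) (by simp; omega)
  refine config_of_rel (V := (Fin c × Fin d) ⊕ Fin θ) c
    (fun p q => decide (extRel c θ R u p q)) ⟨fun p => ?_, fun q => ?_, ?_⟩ _ (by simp)
  · simp only [decide_eq_true_eq]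
    convert extRel_row c θ R hc2 hθ hR u p
  · simp only [decide_eq_true_eq, extRel_transpose c θ R u hu _ q]
    convert extRel_row c θ R hc2 hθ hR (fun i j => - u j i) q
  · intro p p' q q' hp hq h1 h2 h3 h4
    simp only [decide_eq_true_eq] at h1 h2 h3 h4
    exact extRel_noRect c θ R u hu H p p' q q' hp hq h1 h2 h3 h4
end

section
/- Let t ≥ 3, d ≥ t − 2, and v = t·d. Let s : (ℤ/tℤ) × (ℤ/tℤ) → ℤ/dℤ, and let M be the v×v 0,1-matrix with rows and columns indexed by (ℤ/tℤ) × (ℤ/dℤ) defined by M((i,x),(j,y)) = 1 if and only if i ≠ j and y − x = s(i,j); thus M is a block double-circulant matrix whose diagonal blocks are zero and whose off-diagonal blocks are circulant d×d permutation matrices, with weight vector (0,1,1,…,1), and every row and column of M has exactly t − 1 ones. Suppose M contains no 2×2 all-ones submatrix, so that M is an incidence matrix of a symmetric configuration (td)_{t−1}. Then for every integer c with 2 ≤ c ≤ t, every integer θ with 0 ≤ θ ≤ c + 1, and every integer δ with 0 ≤ δ < c − 1, there exists a symmetric configuration v′_{k′} with v′ = c·d + θ and k′ = c − 1 − δ.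 -/
theorem card_filter_sum {α β : Type*} [Fintype α] [Fintype β] [DecidableEq α] [DecidableEq β]
    (p : α ⊕ β → Bool) :
    (Finset.univ.filter (fun j => p j = true)).card =
      (Finset.univ.filter (fun j => p (Sum.inl j) = true)).card +
      (Finset.univ.filter (fun j => p (Sum.inr j) = true)).card := by
  simp only [Finset.card_filter, Fintype.sum_sum_type]

/-- The extended matrix. -/
def extMat {α J : Type*} [Fintype J] [DecidableEq α] (A : α → α → Bool) (E : J → J → Bool)
    (P : J → Finset α) : α ⊕ J → α ⊕ J → Bool
  | Sum.inl a, Sum.inl b => A a b && !(decide (a = b ∧ ∃ r, a ∈ P r))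
  | Sum.inr r, Sum.inl b => decide (b ∈ P r)
  | Sum.inl a, Sum.inr q => decide (a ∈ P q)
  | Sum.inr r, Sum.inr q => E r q

theorem extMat_swap {α J : Type*} [Fintype J] [DecidableEq α] (A : α → α → Bool)
    (E : J → J → Bool) (P : J → Finset α) (u v : α ⊕ J) :
    extMat A E P u v = extMat (fun a b => A b a) (fun r q => E q r) P v u := by
  rcases u with a | r <;> rcases v with b | q <;> simp only [extMat]
  by_cases h : a = b
  · subst h; rfl
  · have h' : ¬ b = a := fun e => h e.symm
    simp [h, h']

theorem extMat_row {α J : Type*} [Fintype α] [Fintype J] [DecidableEq α] [DecidableEq J]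
    (A : α → α → Bool) (E : J → J → Bool) (P : J → Finset α) (k : ℕ)
    (hA : ∀ a, (Finset.univ.filter (fun b => A a b = true)).card = k)
    (hd : ∀ r a, a ∈ P r → A a a = true)
    (hP : ∀ r q a, a ∈ P r → a ∈ P q → r = q)
    (hE : ∀ r, (P r).card + (Finset.univ.filter (fun q => E r q = true)).card = k)
    (u : α ⊕ J) :
    (Finset.univ.filter (fun v => extMat A E P u v = true)).card = k := by
  rw [card_filter_sum]
  rcases u with a | r
  · by_cases h : ∃ r, a ∈ P r
    · obtain ⟨r, hr⟩ := h
      have e1 : (Finset.univ.filter (fun j => extMat A E P (Sum.inl a) (Sum.inl j) = true)) =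
          (Finset.univ.filter (fun b => A a b = true)).erase a := by
        ext b
        have hex : ∃ r, a ∈ P r := ⟨r, hr⟩
        simp only [extMat, Finset.mem_filter, Finset.mem_univ, true_and, Finset.mem_erase,
          Bool.and_eq_true, Bool.not_eq_true', decide_eq_false_iff_not, hex, and_true]
        tauto
      have e2 : (Finset.univ.filter (fun j => extMat A E P (Sum.inl a) (Sum.inr j) = true)) =
          {r} := by
        ext q
        simp only [extMat, Finset.mem_filter, Finset.mem_univ, true_and, Finset.mem_singleton,
          decide_eq_true_eq]
        exact ⟨fun h => hP _ _ _ h hr, fun h => h ▸ hr⟩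
      have hm : a ∈ (Finset.univ.filter (fun b => A a b = true)) := by
        simpa using hd r a hr
      rw [e1, e2, Finset.card_singleton, Finset.card_erase_add_one hm, hA]
    · have h' : ∀ q, a ∉ P q := fun q hq => h ⟨q, hq⟩
      simp [extMat, h', hA]
  · have e1 : (Finset.univ.filter (fun j => extMat A E P (Sum.inr r) (Sum.inl j) = true)) =
        P r := by
      ext b
      rw [Finset.mem_filter]
      simp [extMat]
    rw [e1]
    exact hE r

theorem extMat_noRect {α J : Type*} [Fintype α] [Fintype J] [DecidableEq α] [DecidableEq J]
    (A : α → α → Bool) (E : J → J → Bool) (P : J → Finset α)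
    (hA : NoRect A)
    (hd : ∀ r a, a ∈ P r → A a a = true)
    (hP : ∀ r q a, a ∈ P r → a ∈ P q → r = q)
    (hR : ∀ r a a' b, a ∈ P r → a' ∈ P r → a ≠ a' → A a b = true → A a' b = true → False)
    (hC : ∀ r a a' b, a ∈ P r → a' ∈ P r → a ≠ a' → A b a = true → A b a' = true → False)
    (hE : NoRect E)
    (hEP : ∀ r q a b, E r q = true → a ∈ P r → b ∈ P q → r = q) :
    NoRect (extMat A E P) := by
  have key : ∀ x y r q, x ∈ P q → y ∈ P r → E r q = true →
      (A x y && !(decide (x = y ∧ ∃ r, x ∈ P r))) = true → False := by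
    intro x y r q hx hy he h
    obtain rfl := hEP r q y x he hy hx
    simp only [Bool.and_eq_true, Bool.not_eq_true', decide_eq_false_iff_not] at h
    by_cases hxy : x = y
    · exact h.2 ⟨hxy, r, hx⟩
    · exact hC r x y x hx hy hxy (hd r x hx) h.1
  rintro (x | r) (x' | r') (y | q) (y' | q') h1 h2 <;>
    simp only [extMat, ne_eq, Sum.inl.injEq, Sum.inr.injEq, decide_eq_true_eq] at h1 h2 ⊢ <;>
    intro a b c d
  all_goals first
    | exact key _ _ _ _ b c d a
    | exact key _ _ _ _ a d c b
    | exact key _ _ _ _ d a b c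
    | exact key _ _ _ _ c b a d
    | exact hE _ _ _ _ h1 h2 a b c d
    | exact h1 (hP _ _ _ a c)
    | exact h1 (hP _ _ _ b d)
    | exact h2 (hP _ _ _ a b)
    | exact h2 (hP _ _ _ c d)
    | skip
  all_goals simp only [Bool.and_eq_true] at a b c d
  all_goals first
    | exact hA _ _ _ _ h1 h2 a.1 b.1 c.1 d.1
    | exact hR _ _ _ _ b d h1 a.1 c.1
    | exact hR _ _ _ _ a c h1 b.1 d.1
    | exact hC _ _ _ _ c d h2 a.1 b.1
    | exact hC _ _ _ _ a b h2 c.1 d.1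

theorem config_of_incidence {β : Type*} [Fintype β] (v k : ℕ) (hv : Fintype.card β = v)
    (M : β → β → Bool) (h : IsIncidence k M) : ConfigExists v k := by
  let e : Fin v ≃ β := (Fintype.equivFinOfCardEq hv).symm
  refine ⟨fun i j => M (e i) (e j), ?_, ?_, ?_⟩
  · intro i
    rw [← h.1 (e i)]
    refine Finset.card_equiv e ?_
    simp
  · intro i
    rw [← h.2.1 (e i)]
    refine Finset.card_equiv e ?_
    simp
  · intro i i' j j' h1 h2
    exact h.2.2 _ _ _ _ (fun h => h1 (e.injective h)) (fun h => h2 (e.injective h))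

theorem config_ext {α J : Type*} [Fintype α] [Fintype J] [DecidableEq α] [DecidableEq J]
    (A : α → α → Bool) (E : J → J → Bool) (P : J → Finset α) (k v : ℕ)
    (hv : Fintype.card α + Fintype.card J = v)
    (hA : IsIncidence k A)
    (hd : ∀ r a, a ∈ P r → A a a = true)
    (hP : ∀ r q a, a ∈ P r → a ∈ P q → r = q)
    (hR : ∀ r a a' b, a ∈ P r → a' ∈ P r → a ≠ a' → A a b = true → A a' b = true → False)
    (hC : ∀ r a a' b, a ∈ P r → a' ∈ P r → a ≠ a' → A b a = true → A b a' = true → False)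
    (hE : NoRect E)
    (hE1 : ∀ r, (P r).card + (Finset.univ.filter (fun q => E r q = true)).card = k)
    (hE2 : ∀ r, (P r).card + (Finset.univ.filter (fun q => E q r = true)).card = k)
    (hEP : ∀ r q a b, E r q = true → a ∈ P r → b ∈ P q → r = q) : ConfigExists v k := by
  refine config_of_incidence (β := α ⊕ J) v k (by simpa using hv) (extMat A E P) ⟨?_, ?_, ?_⟩
  · exact extMat_row A E P k hA.1 hd hP hE1
  · intro u
    simp only [extMat_swap A E P _ u]
    exact extMat_row _ _ P k hA.2.1 hd hP hE2 u
  · exact extMat_noRect A E P hA.2.2 hd hP hR hC hE hEP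

/-- Normalised base matrix. -/
def baseMat {n m : ℕ} (k : ℕ) (s : Fin (n+1) → Fin (n+1) → Fin (m+1))
    (a b : Fin (n+1) × Fin (m+1)) : Bool :=
  decide ((b.1 - a.1).val < k ∧ b.2 + s b.1 (b.1 + 1) - a.2 = s a.1 (b.1 + 1))

theorem baseMat_incidence {n m k : ℕ} (hk : k ≤ n) (s : Fin (n+1) → Fin (n+1) → Fin (m+1))
    (hM : NoRect (fun p q : Fin (n+1) × Fin (m+1) =>
      decide (p.1 ≠ q.1 ∧ q.2 - p.2 = s p.1 q.1))) : IsIncidence k (baseMat k s) := by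
  have hkn : k ≤ n + 1 := by omega
  refine ⟨?_, ?_, ?_⟩
  · rintro ⟨i, x⟩
    let f : Fin k → Fin (n+1) × Fin (m+1) := fun l =>
      (i + Fin.castLE hkn l, x + s i (i + Fin.castLE hkn l + 1)
        - s (i + Fin.castLE hkn l) (i + Fin.castLE hkn l + 1))
    have hf : Function.Injective f := by
      intro l l' h
      have h1 := (Prod.ext_iff.1 h).1
      exact Fin.castLE_injective hkn (add_left_cancel h1)
    have : (Finset.univ.filter (fun j => baseMat k s (i, x) j = true)) =
        Finset.univ.image f := by
      ext ⟨j, y⟩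
      simp only [baseMat, Finset.mem_filter, Finset.mem_univ, true_and, decide_eq_true_eq,
        Finset.mem_image, f, Prod.mk.injEq]
      constructor
      · rintro ⟨h1, h2⟩
        have hj : i + Fin.castLE hkn ⟨(j - i).val, h1⟩ = j := by
          have : Fin.castLE hkn ⟨(j - i).val, h1⟩ = j - i := rfl
          rw [this]; abel
        refine ⟨⟨(j - i).val, h1⟩, hj, ?_⟩
        rw [hj, ← h2]; abel
      · rintro ⟨l, rfl, rfl⟩
        refine ⟨?_, by abel⟩
        rw [add_sub_cancel_left]
        exact l.2
    rw [this, Finset.card_image_of_injective _ hf, Finset.card_univ, Fintype.card_fin]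
  · rintro ⟨j, y⟩
    let f : Fin k → Fin (n+1) × Fin (m+1) := fun l =>
      (j - Fin.castLE hkn l, y + s j (j + 1) - s (j - Fin.castLE hkn l) (j + 1))
    have hf : Function.Injective f := by
      intro l l' h
      have h1 := (Prod.ext_iff.1 h).1
      exact Fin.castLE_injective hkn (sub_right_injective h1)
    have : (Finset.univ.filter (fun i => baseMat k s i (j, y) = true)) =
        Finset.univ.image f := by
      ext ⟨i, x⟩
      simp only [baseMat, Finset.mem_filter, Finset.mem_univ, true_and, decide_eq_true_eq,
        Finset.mem_image, f, Prod.mk.injEq]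
      constructor
      · rintro ⟨h1, h2⟩
        have hj : j - Fin.castLE hkn ⟨(j - i).val, h1⟩ = i := by
          have : Fin.castLE hkn ⟨(j - i).val, h1⟩ = j - i := rfl
          rw [this]; abel
        refine ⟨⟨(j - i).val, h1⟩, hj, ?_⟩
        rw [hj, ← h2]; abel
      · rintro ⟨l, rfl, rfl⟩
        refine ⟨?_, by abel⟩
        rw [sub_sub_cancel]
        exact l.2
    rw [this, Finset.card_image_of_injective _ hf, Finset.card_univ, Fintype.card_fin]
  · have key : ∀ a b, baseMat k s a b = true →
        decide (a.1 ≠ b.1 + 1 ∧ (b.2 + s b.1 (b.1 + 1)) - a.2 = s a.1 (b.1 + 1)) = true := by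
      intro a b h
      simp only [baseMat, decide_eq_true_eq] at h ⊢
      refine ⟨fun e => ?_, h.2⟩
      have h1 := h.1
      have : b.1 - a.1 = Fin.last n := by
        rw [e, sub_add_cancel_left, neg_eq_iff_add_eq_zero]
        exact (add_comm _ _).trans (Fin.last_add_one n)
      rw [this] at h1
      simp at h1
      omega
    intro a a' b b' h1 h2 e1 e2 e3 e4
    refine hM a a' (b.1 + 1, b.2 + s b.1 (b.1 + 1)) (b'.1 + 1, b'.2 + s b'.1 (b'.1 + 1)) h1 ?_
      (key _ _ e1) (key _ _ e2) (key _ _ e3) (key _ _ e4)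
    intro h
    simp only [Prod.mk.injEq] at h
    have g1 : b.1 = b'.1 := add_right_cancel h.1
    have g2 := h.2
    rw [g1] at g2
    exact h2 (Prod.ext g1 (add_right_cancel g2))

theorem baseMat_ext {n m k : ℕ} (hk1 : 1 ≤ k) (hk : k ≤ n) (hkm : k ≤ m + 2)
    (s : Fin (n+1) → Fin (n+1) → Fin (m+1))
    (hM : NoRect (fun p q : Fin (n+1) × Fin (m+1) =>
      decide (p.1 ≠ q.1 ∧ q.2 - p.2 = s p.1 q.1)))
    {J : Type*} [Fintype J] [DecidableEq J] (g : J → Option (Fin (n+1)))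
    (hg : ∀ r q i, g r = some i → g q = some i → r = q) (E : J → J → Bool) (hE : NoRect E)
    (hEP : ∀ r q i j, E r q = true → g r = some i → g q = some j → r = q)
    (hE1 : ∀ r, (Finset.univ.filter (fun q => E r q = true)).card = if g r = none then k else 1)
    (hE2 : ∀ r, (Finset.univ.filter (fun q => E q r = true)).card = if g r = none then k else 1) :
    ConfigExists ((n+1) * (m+1) + Fintype.card J) k := by
  obtain ⟨T, -, hT⟩ := Finset.exists_subset_card_eq (s := (Finset.univ : Finset (Fin (m+1))))
    (n := k - 1) (by simp; omega)
  let P : J → Finset (Fin (n+1) × Fin (m+1)) := fun r => (g r).toFinset ×ˢ T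
  have hP : ∀ r a, a ∈ P r ↔ g r = some a.1 ∧ a.2 ∈ T := by
    intro r a
    simp [P, Finset.mem_product, Option.mem_def]
  have hcard : ∀ r, (P r).card + (if g r = none then k else 1) = k := by
    intro r
    simp only [P, Finset.card_product, hT]
    rcases h : g r with _ | i <;> simp
    omega
  refine config_ext (baseMat k s) E P k _ (by simp) (baseMat_incidence hk s hM) ?_ ?_ ?_ ?_ hE
    (fun r => by rw [hE1]; exact hcard r) (fun r => by rw [hE2]; exact hcard r) ?_
  · intro r a _
    simp [baseMat]
    omega
  · intro r q a h1 h2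
    rw [hP] at h1 h2
    exact hg _ _ _ h1.1 h2.1
  · intro r a a' b h1 h2 hne e1 e2
    rw [hP] at h1 h2
    have h3 : a.1 = a'.1 := Option.some.inj (h1.1.symm.trans h2.1)
    simp only [baseMat, decide_eq_true_eq] at e1 e2
    have h4 := e1.2.trans (h3 ▸ e2.2.symm)
    exact hne (Prod.ext h3 (sub_right_injective h4))
  · intro r a a' b h1 h2 hne e1 e2
    rw [hP] at h1 h2
    have h3 : a.1 = a'.1 := Option.some.inj (h1.1.symm.trans h2.1)
    simp only [baseMat, decide_eq_true_eq] at e1 e2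
    have h4 := e1.2
    rw [h3, ← e2.2] at h4
    exact hne (Prod.ext h3 (add_right_cancel (sub_left_injective h4)))
  · intro r q a b e h1 h2
    rw [hP] at h1 h2
    exact hEP r q _ _ e h1.1 h2.1

/-- The corner matrix for `c + 1` new points. -/
def cornerMat {n : ℕ} (k : ℕ) : Option (Fin (n+1)) → Option (Fin (n+1)) → Bool
  | some i, some j => decide (i = j ∧ ¬ i.val < k)
  | some i, none => decide (i.val < k)
  | none, some j => decide (j.val < k)
  | none, none => false

theorem cornerMat_symm {n : ℕ} (k : ℕ) (u v : Option (Fin (n+1))) :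
    cornerMat k u v = cornerMat k v u := by
  rcases u with _ | i <;> rcases v with _ | j <;> simp only [cornerMat]
  by_cases h : i = j
  · subst h; rfl
  · have h' : ¬ j = i := fun e => h e.symm
    simp [h, h']

theorem cornerMat_card {n k : ℕ} (hk : k ≤ n) (r : Option (Fin (n+1))) :
    (Finset.univ.filter (fun q => cornerMat k r q = true)).card = if r = none then k else 1 := by
  rcases r with _ | i
  · have : (Finset.univ.filter (fun q => cornerMat k (none : Option (Fin (n+1))) q = true)) =
      Finset.univ.image (fun l : Fin k => some (Fin.castLE (by omega : k ≤ n + 1) l)) := by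
      ext q
      rcases q with _ | j
      · simp [cornerMat]
      · rw [Finset.mem_filter]
        simp only [cornerMat, Finset.mem_univ, true_and, decide_eq_true_eq,
          Finset.mem_image, Option.some.injEq]
        exact ⟨fun h => ⟨⟨j, h⟩, rfl⟩, fun ⟨l, h⟩ => h ▸ l.2⟩
    rw [this, Finset.card_image_of_injective]
    · simp
    · intro l l' h
      exact Fin.castLE_injective _ (Option.some.inj h)
  · rw [if_neg (by simp), Finset.card_eq_one]
    by_cases h : i.val < k
    · refine ⟨none, ?_⟩
      ext q
      rcases q with _ | j <;> simp [cornerMat, h]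
    · refine ⟨some i, ?_⟩
      ext q
      rcases q with _ | j <;> simp [cornerMat, h]
      exact ⟨fun h => h.1.symm, fun e => ⟨e.symm, by omega⟩⟩

theorem cornerMat_noRect {n k : ℕ} : NoRect (cornerMat (n := n) k) := by
  rintro (_ | i) (_ | i') (_ | j) (_ | j') h1 h2 <;> simp [cornerMat] at h1 h2 ⊢ <;> grind

/-- If a `td × td` block double-circulant matrix whose diagonal blocks are
zero and whose off-diagonal blocks are circulant `d × d` permutation matrices
(weight vector `(0,1,…,1)`) has no 2×2 all-ones submatrix — hence is an
incidence matrix of a symmetric configuration `(td)_{t-1}` — then for every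
`2 ≤ c ≤ t`, `0 ≤ θ ≤ c + 1` and `0 ≤ δ < c - 1`, a symmetric configuration
with `v' = cd + θ` and `k' = c - 1 - δ` exists. -/
theorem config_from_bdc_zero_diagonal_weight (t d : ℕ) (ht : 3 ≤ t)
    (hd : t - 2 ≤ d) (s : Fin t → Fin t → Fin d)
    (hM : NoRect (fun p q : Fin t × Fin d =>
      decide (p.1 ≠ q.1 ∧ q.2 - p.2 = s p.1 q.1)))
    (c θ δ : ℕ) (hc2 : 2 ≤ c) (hct : c ≤ t) (hθ : θ ≤ c + 1) (hδ : δ < c - 1) :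
    ConfigExists (c * d + θ) (c - 1 - δ) := by
  obtain ⟨n, rfl⟩ : ∃ n, c = n + 1 := ⟨c - 1, by omega⟩
  obtain ⟨m, rfl⟩ : ∃ m, d = m + 1 := ⟨d - 1, by omega⟩
  let s' : Fin (n+1) → Fin (n+1) → Fin (m+1) := fun i j => s (Fin.castLE hct i) (Fin.castLE hct j)
  have hM' : NoRect (fun p q : Fin (n+1) × Fin (m+1) =>
      decide (p.1 ≠ q.1 ∧ q.2 - p.2 = s' p.1 q.1)) := by
    have inj : Function.Injective (Prod.map (Fin.castLE hct) (id : Fin (m+1) → Fin (m+1))) :=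
      (Fin.castLE_injective hct).prodMap Function.injective_id
    intro a a' b b' h1 h2 e1 e2 e3 e4
    have key : ∀ a b : Fin (n+1) × Fin (m+1),
        decide (a.1 ≠ b.1 ∧ b.2 - a.2 = s' a.1 b.1) = true →
        decide (Fin.castLE hct a.1 ≠ Fin.castLE hct b.1 ∧ b.2 - a.2 = s' a.1 b.1) = true := by
      intro a b h
      simp only [decide_eq_true_eq] at h ⊢
      exact ⟨fun e => h.1 (Fin.castLE_injective hct e), h.2⟩
    exact hM (Prod.map (Fin.castLE hct) id a) (Prod.map (Fin.castLE hct) id a')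
      (Prod.map (Fin.castLE hct) id b) (Prod.map (Fin.castLE hct) id b')
      (fun h => h1 (inj h)) (fun h => h2 (inj h))
      (key _ _ e1) (key _ _ e2) (key _ _ e3) (key _ _ e4)
  by_cases hθc : θ ≤ n + 1
  · have := baseMat_ext (k := n + 1 - 1 - δ) (by omega) (by omega) (by omega) s' hM'
      (J := Fin θ) (fun r => some (Fin.castLE hθc r))
      (fun r q i h1 h2 => Fin.castLE_injective hθc (Option.some.inj (h1.trans h2.symm)))
      (fun r q => decide (r = q))
      (by
        intro r r' q q' h1 _ e1 _ e3 _
        simp only [decide_eq_true_eq] at e1 e3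
        exact h1 (e1.trans e3.symm))
      (fun r q _ _ h _ _ => by simpa using h)
      (fun r => by
        rw [if_neg (by simp), Finset.card_eq_one]
        refine ⟨r, ?_⟩
        ext q
        rw [Finset.mem_filter]
        simp [eq_comm])
      (fun r => by
        rw [if_neg (by simp), Finset.card_eq_one]
        refine ⟨r, ?_⟩
        ext q
        rw [Finset.mem_filter]
        simp)
    simpa using this
  · obtain rfl : θ = n + 1 + 1 := by omega
    have := baseMat_ext (k := n + 1 - 1 - δ) (by omega) (by omega) (by omega) s' hM'
      (J := Option (Fin (n+1))) id
      (fun r q i h1 h2 => h1.trans h2.symm)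
      (cornerMat (n + 1 - 1 - δ)) cornerMat_noRect
      (by
        rintro r q i j h hr hq
        simp only [id] at hr hq
        subst hr hq
        simp only [cornerMat, decide_eq_true_eq] at h
        rw [h.1])
      (fun r => cornerMat_card (by omega) r)
      (fun r => by
        simp only [cornerMat_symm _ _ r]
        exact cornerMat_card (by omega) r)
    simpa using this
end
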